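/- arXiv:1206.4295 — 3 statements merged into one kernel-verified Lean document; each statement's English description precedes it below -/
import Mathlib

section
/- (Nonnegativity part of Proposition 4.1.) Let 1 < p < ∞, let Ω ⊂ ℝ^N be a bounded domain and let O be an open subset of Ω with λ1(Ω) < λ1(O). If w is C^1 on the closure of O, w ≥ 0 on ∂O, and w is a weak solution of −Δ_p w = λ1(Ω) |w|^{p−2} w in O, then w ≥ 0 throughout O. -/
open MeasureTheory RealInnerProductSpace Metric Set

noncomputable section

/-- Smooth test functions compactly supported in `U` (the class `C_c^∞(U)`). -/
def IsTestFun {N : ℕ} (U : Set (EuclideanSpace ℝ (Fin N)))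
    (φ : EuclideanSpace ℝ (Fin N) → ℝ) : Prop :=
  ContDiff ℝ (⊤ : ℕ∞) φ ∧ HasCompactSupport φ ∧ tsupport φ ⊆ U

/-- `u` is a weak solution of `-Δ_p u = h` in `U`:
`∫_U |∇u|^{p-2} ⟨∇u, ∇φ⟩ = ∫_U h φ` for all test functions `φ`. -/
def IsWeakSolution (p : ℝ) {N : ℕ} (U : Set (EuclideanSpace ℝ (Fin N)))
    (u h : EuclideanSpace ℝ (Fin N) → ℝ) : Prop :=
  ∀ φ : EuclideanSpace ℝ (Fin N) → ℝ, IsTestFun U φ →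
    (∫ x in U, ‖gradient u x‖ ^ (p - 2) * ⟪gradient u x, gradient φ x⟫)
      = ∫ x in U, h x * φ x

/-- The `p`-torsional rigidity of `U`:
`E(U) = (p/(p-1)) ⬝ sup { ∫_U φ - (1/p) ∫_U |∇φ|^p : φ ∈ C_c^∞(U) }`. -/
def pTorsionalRigidity (p : ℝ) {N : ℕ} (U : Set (EuclideanSpace ℝ (Fin N))) : ℝ :=
  (p / (p - 1)) *
    sSup { r : ℝ | ∃ φ, IsTestFun U φ ∧
      r = (∫ x in U, φ x) - (1 / p) * ∫ x in U, ‖gradient φ x‖ ^ p }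

/-- The first Dirichlet eigenvalue of the `p`-Laplacian on `U`:
`λ₁(U) = inf { (∫_U |∇φ|^p)/(∫_U |φ|^p) : φ ∈ C_c^∞(U), φ ≢ 0 }`. -/
def pLambda1 (p : ℝ) {N : ℕ} (U : Set (EuclideanSpace ℝ (Fin N))) : ℝ :=
  sInf { r : ℝ | ∃ φ, IsTestFun U φ ∧ φ ≠ 0 ∧
    r = (∫ x in U, ‖gradient φ x‖ ^ p) / (∫ x in U, |φ x| ^ p) }

/-- `f` is `C^1` on the closure of `U` (i.e. `C^1` on an open neighbourhood of it). -/
def C1OnClosure {N : ℕ} (U : Set (EuclideanSpace ℝ (Fin N)))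
    (f : EuclideanSpace ℝ (Fin N) → ℝ) : Prop :=
  ∃ W, IsOpen W ∧ closure U ⊆ W ∧ ContDiffOn ℝ 1 f W

/-- `Ω` has a smooth boundary: it is the sublevel set of a smooth function whose
differential does not vanish on the boundary. -/
def HasSmoothBoundary {N : ℕ} (Ω : Set (EuclideanSpace ℝ (Fin N))) : Prop :=
  ∃ f : EuclideanSpace ℝ (Fin N) → ℝ, ContDiff ℝ (⊤ : ℕ∞) f ∧ Ω = f ⁻¹' Set.Iio 0 ∧
    ∀ x ∈ frontier Ω, fderiv ℝ f x ≠ 0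

/-- The index of the first coordinate. -/
def firstIdx (N : ℕ) (hN : 2 ≤ N) : Fin N := ⟨0, by omega⟩

/-- The first standard basis vector `e₁`. -/
def e1v {N : ℕ} (hN : 2 ≤ N) : EuclideanSpace ℝ (Fin N) :=
  EuclideanSpace.single (firstIdx N hN) 1

/-- The domain `Ω(s) = B(0,r1) \ closure B(s e₁, r0)`. -/
def annulus {N : ℕ} (hN : 2 ≤ N) (r0 r1 s : ℝ) : Set (EuclideanSpace ℝ (Fin N)) :=
  Metric.ball (0 : EuclideanSpace ℝ (Fin N)) r1 \ closure (Metric.ball (s • e1v hN) r0)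

/-- Reflection across the hyperplane `{x₁ = s}`: `x ↦ (2s - x₁, x₂, …, x_N)`. -/
def reflectH {N : ℕ} (hN : 2 ≤ N) (s : ℝ) (x : EuclideanSpace ℝ (Fin N)) :
    EuclideanSpace ℝ (Fin N) :=
  x + (2 * (s - x (firstIdx N hN))) • e1v hN

/-- The divergence of a vector field, as the trace of its Jacobian. -/
def divergence {N : ℕ} (V : EuclideanSpace ℝ (Fin N) → EuclideanSpace ℝ (Fin N))
    (x : EuclideanSpace ℝ (Fin N)) : ℝ :=
  LinearMap.trace ℝ _ (fderiv ℝ V x : EuclideanSpace ℝ (Fin N) →ₗ[ℝ] EuclideanSpace ℝ (Fin N))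

/-- The classical `p`-Laplacian `Δ_p b = div(|∇b|^{p-2} ∇b)` at a point. -/
def pLapAt (p : ℝ) {N : ℕ} (b : EuclideanSpace ℝ (Fin N) → ℝ)
    (x : EuclideanSpace ℝ (Fin N)) : ℝ :=
  divergence (fun z => ‖gradient b z‖ ^ (p - 2) • gradient b z) x

/-- The torsion function of `U`: `C^1` up to the boundary, vanishing on the boundary,
positive inside, weak solution of `-Δ_p y = 1`. -/
def IsTorsionFn (p : ℝ) {N : ℕ} (U : Set (EuclideanSpace ℝ (Fin N)))
    (y : EuclideanSpace ℝ (Fin N) → ℝ) : Prop :=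
  C1OnClosure U y ∧ (∀ x ∈ frontier U, y x = 0) ∧ (∀ x ∈ U, 0 < y x) ∧
    IsWeakSolution p U y (fun _ => 1)

/-- A first eigenfunction of the Dirichlet `p`-Laplacian on `U`: `C^1` up to the boundary,
positive inside, vanishing on the boundary, `L^p`-normalized, weak solution of
`-Δ_p u = λ₁(U) u^{p-1}`. -/
def IsFirstEigenfun (p : ℝ) {N : ℕ} (U : Set (EuclideanSpace ℝ (Fin N)))
    (y : EuclideanSpace ℝ (Fin N) → ℝ) : Prop :=
  C1OnClosure U y ∧ (∀ x ∈ U, 0 < y x) ∧ (∀ x ∈ frontier U, y x = 0) ∧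
    (∫ x in U, y x ^ p) = 1 ∧
    IsWeakSolution p U y (fun x => pLambda1 p U * y x ^ (p - 1))

/-- The matrix `DA(x) = |x|^{p-2} I + (p-2)|x|^{p-4} x xᵀ`,
the derivative of `A(x) = |x|^{p-2} x`. -/
def DA (p : ℝ) {N : ℕ} (x : EuclideanSpace ℝ (Fin N)) :
    EuclideanSpace ℝ (Fin N) →L[ℝ] EuclideanSpace ℝ (Fin N) :=
  ‖x‖ ^ (p - 2) • ContinuousLinearMap.id ℝ (EuclideanSpace ℝ (Fin N)) +
    ((p - 2) * ‖x‖ ^ (p - 4)) • (innerSL ℝ x).smulRight x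

/-- `w` is a nonnegative bounded weak solution, continuous on the closure of `Ω` and `C^1`
inside, of `-Δ_p w = F(x, w)` in `Ω` with boundary value `bdry` on `∂Ω`. -/
def SolClass (p : ℝ) {N : ℕ} (Ω : Set (EuclideanSpace ℝ (Fin N)))
    (F : EuclideanSpace ℝ (Fin N) → ℝ → ℝ)
    (bdry w : EuclideanSpace ℝ (Fin N) → ℝ) : Prop :=
  ContinuousOn w (closure Ω) ∧ ContDiffOn ℝ 1 w Ω ∧
    (∀ x ∈ closure Ω, 0 ≤ w x) ∧ (∃ M, ∀ x ∈ closure Ω, |w x| ≤ M) ∧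
    IsWeakSolution p Ω w (fun x => F x (w x)) ∧ (∀ x ∈ frontier Ω, w x = bdry x)

section

open Filter Topology

/-- Compactly supported `C¹` functions are limits of smooth test functions, uniformly together
with their gradients. -/
theorem exists_isTestFun_forall_dist_le {N : ℕ} {U : Set (EuclideanSpace ℝ (Fin N))}
    (hU : IsOpen U) {φ : EuclideanSpace ℝ (Fin N) → ℝ} (hφ : ContDiff ℝ 1 φ)
    (hc : HasCompactSupport φ) (hs : tsupport φ ⊆ U) {δ : ℝ} (hδ : 0 < δ) :
    ∃ ψ, IsTestFun U ψ ∧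
      ∀ x, |ψ x - φ x| ≤ δ ∧ ‖gradient ψ x - gradient φ x‖ ≤ δ := by
  have hd : Continuous (fderiv ℝ φ) := hφ.continuous_fderiv one_ne_zero
  obtain ⟨r₁, hr₁, h₁⟩ := Metric.uniformContinuous_iff.1
    (hc.uniformContinuous_of_continuous hφ.continuous) δ hδ
  obtain ⟨r₂, hr₂, h₂⟩ := Metric.uniformContinuous_iff.1
    ((hc.fderiv (𝕜 := ℝ)).uniformContinuous_of_continuous hd) δ hδ
  obtain ⟨r₃, hr₃, h₃⟩ := hc.isCompact.exists_cthickening_subset_open hU hs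
  obtain ⟨r, hr, hlt⟩ := exists_between (lt_min (lt_min hr₁ hr₂) hr₃)
  simp only [lt_min_iff] at hlt
  let η : ContDiffBump (0 : EuclideanSpace ℝ (Fin N)) := ⟨r / 2, r, half_pos hr, half_lt_self hr⟩
  have hη : LocallyIntegrable (η.normed volume) :=
    (η.contDiff_normed (n := 0)).continuous.locallyIntegrable
  set ψ := convolution (η.normed volume) φ (ContinuousLinearMap.lsmul ℝ ℝ) volume with hψ
  have key : ∀ x ε, (∀ y ∈ ball x r, dist (φ y) (φ x) ≤ ε) → dist (ψ x) (φ x) ≤ ε := fun x ε h =>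
    η.dist_normed_convolution_le hφ.continuous.aestronglyMeasurable h
  have hsupp : tsupport ψ ⊆ cthickening r (tsupport φ) := by
    refine closure_minimal (fun x hx => ?_) isClosed_cthickening
    by_contra hx'
    have h0 : ∀ y ∈ ball x r, φ y = 0 := fun y hy => by
      by_contra hy0
      exact hx' (mem_cthickening_of_dist_le x y r _ (subset_tsupport φ hy0)
        (by rw [dist_comm]; exact (mem_ball.1 hy).le))
    have hx0 := h0 x (mem_ball_self hr)
    have := key x 0 fun y hy => by simp [h0 y hy, hx0]
    exact hx (by simpa [hx0] using this)
  refine ⟨ψ, ⟨?_, ?_, ?_⟩, fun x => ⟨?_, ?_⟩⟩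
  · exact η.hasCompactSupport_normed.contDiff_convolution_left _ η.contDiff_normed
      hφ.continuous.locallyIntegrable
  · exact hc.isCompact.cthickening.of_isClosed_subset (isClosed_tsupport _) hsupp
  · exact hsupp.trans ((cthickening_mono hlt.2.le _).trans h₃)
  · rw [← Real.dist_eq]
    exact key x δ fun y hy => (h₁ (lt_trans (mem_ball.1 hy) hlt.1.1)).le
  · have hf := (hc.hasFDerivAt_convolution_right (ContinuousLinearMap.lsmul ℝ ℝ) hη hφ x).fderiv
    rw [gradient, gradient, ← map_sub, LinearIsometryEquiv.norm_map, ← dist_eq_norm, hf]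
    refine η.dist_normed_convolution_le (g := fderiv ℝ φ) hd.aestronglyMeasurable
      fun y hy => (h₂ (lt_trans (mem_ball.1 hy) hlt.1.2)).le

theorem tendsto_setIntegral_of_forall_norm_le {N : ℕ} {U : Set (EuclideanSpace ℝ (Fin N))}
    (hU : IsOpen U) (hUb : Bornology.IsBounded U)
    {F : ℕ → EuclideanSpace ℝ (Fin N) → ℝ} {f : EuclideanSpace ℝ (Fin N) → ℝ} (C : ℝ)
    (hF : ∀ n, AEStronglyMeasurable (F n) (volume.restrict U))
    (hC : ∀ n, ∀ x ∈ U, ‖F n x‖ ≤ C)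
    (hlim : ∀ x ∈ U, Tendsto (fun n => F n x) atTop (𝓝 (f x))) :
    Tendsto (fun n => ∫ x in U, F n x) atTop (𝓝 (∫ x in U, f x)) := by
  refine tendsto_integral_of_dominated_convergence (fun _ => C) hF ?_ ?_ ?_
  · exact integrableOn_const hUb.measure_lt_top.ne
  · exact fun n => (ae_restrict_iff' hU.measurableSet).2 (ae_of_all _ (hC n))
  · exact (ae_restrict_iff' hU.measurableSet).2 (ae_of_all _ hlim)

theorem measurable_gradient {N : ℕ} (f : EuclideanSpace ℝ (Fin N) → ℝ) :
    Measurable (gradient f) :=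
  (LinearIsometryEquiv.continuous _).measurable.comp (measurable_fderiv ℝ f)

/-- A `C¹` function with compact support in `U` is approximated by a sequence of smooth
test functions, pointwise together with gradients, with uniform bounds. -/
theorem exists_seq_isTestFun_tendsto {N : ℕ} {U : Set (EuclideanSpace ℝ (Fin N))}
    (hU : IsOpen U) {φ : EuclideanSpace ℝ (Fin N) → ℝ} (hφ : ContDiff ℝ 1 φ)
    (hc : HasCompactSupport φ) (hs : tsupport φ ⊆ U) :
    ∃ ψ : ℕ → EuclideanSpace ℝ (Fin N) → ℝ, (∀ n, IsTestFun U (ψ n)) ∧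
      (∃ C, ∀ n x, |ψ n x| ≤ C ∧ ‖gradient (ψ n) x‖ ≤ C) ∧
      (∀ x, Tendsto (fun n => ψ n x) atTop (𝓝 (φ x))) ∧
      ∀ x, Tendsto (fun n => gradient (ψ n) x) atTop (𝓝 (gradient φ x)) := by
  choose ψ hψ hd using fun n : ℕ => exists_isTestFun_forall_dist_le hU hφ hc hs
    (Nat.one_div_pos_of_nat (α := ℝ) (n := n))
  obtain ⟨C₁, h₁⟩ := hc.exists_bound_of_continuous hφ.continuous
  obtain ⟨C₂, h₂⟩ := (hc.fderiv (𝕜 := ℝ)).exists_bound_of_continuous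
    (hφ.continuous_fderiv one_ne_zero)
  have hle : ∀ n : ℕ, 1 / ((n : ℝ) + 1) ≤ 1 := fun n => by
    rw [div_le_one (by positivity)]
    linarith [n.cast_nonneg (α := ℝ)]
  refine ⟨ψ, hψ, ⟨max C₁ C₂ + 1, fun n x => ⟨?_, ?_⟩⟩, fun x => ?_, fun x => ?_⟩
  · have h := abs_sub_abs_le_abs_sub (ψ n x) (φ x)
    have h' := h₁ x
    rw [Real.norm_eq_abs] at h'
    linarith [(hd n x).1, hle n, le_max_left C₁ C₂]
  · have h := norm_sub_norm_le (gradient (ψ n) x) (gradient φ x)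
    have h' : ‖gradient φ x‖ ≤ C₂ := by
      rw [gradient, LinearIsometryEquiv.norm_map]
      exact h₂ x
    linarith [(hd n x).2, hle n, le_max_right C₁ C₂]
  · rw [tendsto_iff_norm_sub_tendsto_zero]
    exact squeeze_zero (fun _ => norm_nonneg _) (fun n => (hd n x).1)
      tendsto_one_div_add_atTop_nhds_zero_nat
  · rw [tendsto_iff_norm_sub_tendsto_zero]
    exact squeeze_zero (fun _ => norm_nonneg _) (fun n => (hd n x).2)
      tendsto_one_div_add_atTop_nhds_zero_nat

theorem pLambda1_nonneg (p : ℝ) {N : ℕ} (U : Set (EuclideanSpace ℝ (Fin N))) :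
    0 ≤ pLambda1 p U := by
  refine Real.sInf_nonneg ?_
  rintro r ⟨φ, -, -, rfl⟩
  positivity

/-- The Poincaré inequality with constant `λ₁(U)`, for test functions. -/
theorem IsTestFun.pLambda1_mul_le {p : ℝ} (hp : 0 < p) {N : ℕ}
    {U : Set (EuclideanSpace ℝ (Fin N))} {φ : EuclideanSpace ℝ (Fin N) → ℝ}
    (hφ : IsTestFun U φ) :
    pLambda1 p U * ∫ x in U, |φ x| ^ p ≤ ∫ x in U, ‖gradient φ x‖ ^ p := by
  have hnn : 0 ≤ ∫ x in U, ‖gradient φ x‖ ^ p := by positivity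
  by_cases h0 : φ = 0
  · simpa [h0, Real.zero_rpow hp.ne'] using hnn
  rcases (show 0 ≤ ∫ x in U, |φ x| ^ p by positivity).eq_or_lt with h | h
  · simpa [← h] using hnn
  rw [← le_div_iff₀ h]
  refine csInf_le ⟨0, ?_⟩ ⟨φ, hφ, h0, rfl⟩
  rintro r ⟨φ, -, -, rfl⟩
  positivity

/-- The Poincaré inequality with constant `λ₁(U)`, for `C¹` functions. -/
theorem pLambda1_mul_le_of_contDiff {p : ℝ} (hp : 0 < p) {N : ℕ}
    {U : Set (EuclideanSpace ℝ (Fin N))} (hU : IsOpen U) (hUb : Bornology.IsBounded U)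
    {φ : EuclideanSpace ℝ (Fin N) → ℝ} (hφ : ContDiff ℝ 1 φ)
    (hc : HasCompactSupport φ) (hs : tsupport φ ⊆ U) :
    pLambda1 p U * ∫ x in U, |φ x| ^ p ≤ ∫ x in U, ‖gradient φ x‖ ^ p := by
  obtain ⟨ψ, hψ, ⟨C, hC⟩, h₁, h₂⟩ := exists_seq_isTestFun_tendsto hU hφ hc hs
  refine le_of_tendsto_of_tendsto' (b := atTop) (Tendsto.const_mul _ ?_) ?_
    fun n => (hψ n).pLambda1_mul_le hp
  · refine tendsto_setIntegral_of_forall_norm_le hU hUb (C ^ p) (fun n => ?_) (fun n x _ => ?_)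
      fun x _ => ((h₁ x).abs).rpow_const (Or.inr hp.le)
    · exact ((hψ n).1.continuous.abs.measurable.pow_const p).aestronglyMeasurable
    · rw [Real.norm_of_nonneg (by positivity)]
      exact Real.rpow_le_rpow (abs_nonneg _) (hC n x).1 hp.le
  · refine tendsto_setIntegral_of_forall_norm_le hU hUb (C ^ p) (fun n => ?_) (fun n x _ => ?_)
      fun x _ => ((h₂ x).norm).rpow_const (Or.inr hp.le)
    · exact ((measurable_gradient _).norm.pow_const p).aestronglyMeasurable
    · rw [Real.norm_of_nonneg (by positivity)]
      exact Real.rpow_le_rpow (norm_nonneg _) (hC n x).2 hp.le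

/-- A weak solution with bounded gradient and bounded right-hand side may be tested against
compactly supported `C¹` functions. -/
theorem IsWeakSolution.integral_eq_of_contDiff {p : ℝ} (hp : 1 < p) {N : ℕ}
    {U : Set (EuclideanSpace ℝ (Fin N))} (hU : IsOpen U) (hUb : Bornology.IsBounded U)
    {u h : EuclideanSpace ℝ (Fin N) → ℝ} (hu : IsWeakSolution p U u h) {M : ℝ}
    (hM : ∀ x ∈ U, ‖gradient u x‖ ≤ M) {K : ℝ} (hK : ∀ x ∈ U, |h x| ≤ K)
    (hmeas : AEStronglyMeasurable h (volume.restrict U))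
    {φ : EuclideanSpace ℝ (Fin N) → ℝ} (hφ : ContDiff ℝ 1 φ)
    (hc : HasCompactSupport φ) (hs : tsupport φ ⊆ U) :
    (∫ x in U, ‖gradient u x‖ ^ (p - 2) * ⟪gradient u x, gradient φ x⟫)
      = ∫ x in U, h x * φ x := by
  obtain ⟨ψ, hψ, ⟨C, hC⟩, h₁, h₂⟩ := exists_seq_isTestFun_tendsto hU hφ hc hs
  have hmg := measurable_gradient u
  have hL := tendsto_setIntegral_of_forall_norm_le hU hUb
    (F := fun n x => ‖gradient u x‖ ^ (p - 2) * ⟪gradient u x, gradient (ψ n) x⟫)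
    (M ^ (p - 1) * C)
    (fun n => ((hmg.norm.pow_const _).mul (hmg.inner (measurable_gradient _))).aestronglyMeasurable)
    (fun n x hx => ?_) fun x _ => (tendsto_const_nhds.inner (h₂ x)).const_mul _
  · have hR := tendsto_setIntegral_of_forall_norm_le hU hUb (F := fun n x => h x * ψ n x) (K * C)
      (fun n => hmeas.mul (hψ n).1.continuous.aestronglyMeasurable)
      (fun n x hx => ?_) fun x _ => (h₁ x).const_mul _
    · exact tendsto_nhds_unique (hL.congr fun n => hu (ψ n) (hψ n)) hR
    · rw [norm_mul]
      exact mul_le_mul (hK x hx) (hC n x).1 (norm_nonneg _) ((abs_nonneg _).trans (hK x hx))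
  · have hC0 : 0 ≤ C := (abs_nonneg _).trans (hC n x).1
    rcases eq_or_ne (gradient u x) 0 with h0 | h0
    · have := Real.rpow_nonneg ((norm_nonneg _).trans (hM x hx)) (p - 1)
      simpa [h0] using mul_nonneg this hC0
    have hpos := norm_pos_iff.2 h0
    calc ‖‖gradient u x‖ ^ (p - 2) * ⟪gradient u x, gradient (ψ n) x⟫‖
        ≤ ‖gradient u x‖ ^ (p - 2) * (‖gradient u x‖ * C) := by
          rw [norm_mul, Real.norm_of_nonneg (by positivity)]
          gcongr
          exact (norm_inner_le_norm _ _).trans (by gcongr; exact (hC n x).2)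
      _ = ‖gradient u x‖ ^ (p - 1) * C := by
          rw [← mul_assoc, ← Real.rpow_add_one hpos.ne']
          congr 2
          ring
      _ ≤ M ^ (p - 1) * C := by
          have := Real.rpow_le_rpow hpos.le (hM x hx) (sub_pos.2 hp).le
          gcongr

/-- A `C¹` convex approximation of the negative part, vanishing on `[-ε, ∞)`. -/
theorem exists_smooth_negPart_approx {ε : ℝ} (hε : 0 < ε) :
    ∃ H D : ℝ → ℝ, (∀ t, HasDerivAt H (D t) t) ∧ Continuous D ∧ (∀ t, -1 ≤ D t ∧ D t ≤ 0) ∧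
      (∀ t, 0 ≤ H t) ∧ (∀ t, -ε ≤ t → H t = 0) ∧ (∀ t, H t ≤ t⁻) ∧ ∀ t, t⁻ - 2 * ε ≤ H t := by
  have hq : ∀ r : ℝ, HasDerivAt (fun r : ℝ => (max r 0) ^ 2) (2 * max r 0) r := by
    intro r
    rcases lt_trichotomy r 0 with hr | rfl | hr
    · rw [max_eq_right hr.le, mul_zero]
      refine (hasDerivAt_const r (0 : ℝ)).congr_of_eventuallyEq ?_
      filter_upwards [Iio_mem_nhds hr] with x hx
      simp [max_eq_right (le_of_lt (mem_Iio.1 hx))]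
    · rw [hasDerivAt_iff_isLittleO_nhds_zero]
      have h : (fun h : ℝ => (max h 0) ^ 2) =O[𝓝 0] fun h : ℝ => h ^ 2 := by
        refine Asymptotics.isBigO_of_le _ fun x => ?_
        rcases le_total x 0 with hx | hx
        · simp [hx, sq_nonneg]
        · simp [hx]
      simpa using h.trans_isLittleO (Asymptotics.isLittleO_pow_id one_lt_two)
    · rw [max_eq_left hr.le]
      refine (by simpa using hasDerivAt_pow 2 r : HasDerivAt (fun x : ℝ => x ^ 2) (2 * r) r)
        |>.congr_of_eventuallyEq ?_
      filter_upwards [Ioi_mem_nhds hr] with x hx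
      rw [max_eq_left (le_of_lt (mem_Ioi.1 hx))]
  have hpos : ∀ t : ℝ, 0 < (max (-t - ε) 0) ^ 2 + ε ^ 2 := fun t => by positivity
  have hle : ∀ t : ℝ, max (-t - ε) 0 ≤ √((max (-t - ε) 0) ^ 2 + ε ^ 2) := fun t =>
    Real.le_sqrt_of_sq_le (by nlinarith)
  refine ⟨fun t => √((max (-t - ε) 0) ^ 2 + ε ^ 2) - ε,
    fun t => -max (-t - ε) 0 / √((max (-t - ε) 0) ^ 2 + ε ^ 2),
    fun t => ?_, ?_, fun t => ⟨?_, ?_⟩, fun t => ?_, fun t ht => ?_, fun t => ?_, fun t => ?_⟩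
  · have h := (((hq (-t - ε)).comp t (((hasDerivAt_id t).neg).sub_const ε)).add_const
      (ε ^ 2)).sqrt (hpos t).ne'
    refine (h.sub_const ε).congr_deriv ?_
    change 2 * max (-t - ε) 0 * -1 / (2 * √((max (-t - ε) 0) ^ 2 + ε ^ 2)) = _
    field_simp
  · exact Continuous.div (by fun_prop) (by fun_prop) fun t => (Real.sqrt_pos.2 (hpos t)).ne'
  · rw [le_div_iff₀ (Real.sqrt_pos.2 (hpos t))]
    linarith [hle t]
  · exact div_nonpos_of_nonpos_of_nonneg (by simp) (Real.sqrt_nonneg _)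
  · exact sub_nonneg.2 (Real.le_sqrt_of_sq_le (by nlinarith [sq_nonneg (max (-t - ε) 0)]))
  · simp [max_eq_right (show -t - ε ≤ 0 by linarith), Real.sqrt_sq hε.le]
  · have hm : max (-t - ε) 0 ≤ t⁻ := by
      rw [negPart_def]
      exact max_le_max (by linarith) le_rfl
    refine le_trans ?_ hm
    rw [sub_le_iff_le_add, Real.sqrt_le_left (by positivity)]
    nlinarith [le_max_right (-t - ε) 0]
  · have hm : t⁻ - ε ≤ max (-t - ε) 0 := by
      rw [negPart_def, sub_le_iff_le_add]
      refine max_le ?_ ?_ <;> linarith [le_max_left (-t - ε) 0, le_max_right (-t - ε) 0]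
    dsimp only
    linarith [hle t]

/-- Composing a function which is nonnegative on the boundary with a `C¹` function vanishing on
`[-ε, ∞)` and extending by zero gives a `C¹` function compactly supported inside. -/
theorem contDiff_indicator_comp {N : ℕ} {O : Set (EuclideanSpace ℝ (Fin N))} (hO : IsOpen O)
    (hOb : Bornology.IsBounded O) {w : EuclideanSpace ℝ (Fin N) → ℝ}
    (hwc : ContinuousOn w (closure O)) (hw : ContDiffOn ℝ 1 w O)
    (hwbd : ∀ x ∈ frontier O, 0 ≤ w x) {ε : ℝ} (hε : 0 < ε) {H : ℝ → ℝ} (hH : ContDiff ℝ 1 H)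
    (hH0 : ∀ t, -ε ≤ t → H t = 0) :
    ContDiff ℝ 1 (O.indicator (H ∘ w)) ∧ HasCompactSupport (O.indicator (H ∘ w)) ∧
      tsupport (O.indicator (H ∘ w)) ⊆ O := by
  set K := closure O ∩ w ⁻¹' Iic (-ε) with hK
  have hKc : IsClosed K := hwc.preimage_isClosed_of_isClosed isClosed_closure isClosed_Iic
  have hKO : K ⊆ O := fun x hx => by
    by_contra hxO
    have h0 := hwbd x ⟨hx.1, by rwa [hO.interior_eq]⟩
    have : w x ≤ -ε := hx.2
    linarith
  have hts : tsupport (O.indicator (H ∘ w)) ⊆ K := by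
    refine closure_minimal (fun x hx => ?_) hKc
    have hxO : x ∈ O := by
      by_contra hxO
      exact hx (indicator_of_notMem hxO _)
    refine ⟨subset_closure hxO, ?_⟩
    by_contra hlt
    exact hx (by rw [indicator_of_mem hxO]; exact hH0 _ (le_of_lt (not_le.1 hlt)))
  have hKcomp : IsCompact K :=
    Metric.isCompact_of_isClosed_isBounded hKc (hOb.subset hKO)
  refine ⟨contDiff_iff_contDiffAt.2 fun x => ?_, hKcomp.of_isClosed_subset (isClosed_tsupport _) hts,
    hts.trans hKO⟩
  by_cases hx : x ∈ O
  · refine (hH.contDiffAt.comp x (hw.contDiffAt (hO.mem_nhds hx))).congr_of_eventuallyEq ?_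
    filter_upwards [hO.mem_nhds hx] with y hy using indicator_of_mem hy _
  · have h0 : O.indicator (H ∘ w) =ᶠ[𝓝 x] 0 :=
      notMem_tsupport_iff_eventuallyEq.1 fun h => hx (hKO (hts h))
    exact contDiffAt_const.congr_of_eventuallyEq h0

theorem HasDerivAt.gradient_comp {N : ℕ} {w : EuclideanSpace ℝ (Fin N) → ℝ}
    {x : EuclideanSpace ℝ (Fin N)} {H : ℝ → ℝ} {d : ℝ} (hH : HasDerivAt H d (w x))
    (hw : DifferentiableAt ℝ w x) : gradient (H ∘ w) x = d • gradient w x := by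
  rw [gradient, gradient, (hH.comp_hasFDerivAt x hw.hasFDerivAt).fderiv, map_smul]

/-- Testing the equation against a truncation of `w⁻`. -/
theorem pLambda1_mul_integral_truncation_le {p : ℝ} (hp : 1 < p) {N : ℕ}
    {O : Set (EuclideanSpace ℝ (Fin N))} (hO : IsOpen O) (hOb : Bornology.IsBounded O)
    {w : EuclideanSpace ℝ (Fin N) → ℝ} (hw : C1OnClosure O w)
    (hwbd : ∀ x ∈ frontier O, 0 ≤ w x) {l : ℝ} (hl : 0 ≤ l)
    (hsol : IsWeakSolution p O w (fun x => l * (|w x| ^ (p - 2) * w x)))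
    {ε : ℝ} (hε : 0 < ε) {H D : ℝ → ℝ} (hH : ∀ t, HasDerivAt H (D t) t) (hD : Continuous D)
    (hD1 : ∀ t, -1 ≤ D t ∧ D t ≤ 0) (hHn : ∀ t, 0 ≤ H t) (hH0 : ∀ t, -ε ≤ t → H t = 0)
    (hHle : ∀ t, H t ≤ t⁻) :
    pLambda1 p O * ∫ x in O, (H (w x)) ^ p ≤ l * ∫ x in O, (w x)⁻ ^ p := by
  obtain ⟨W, hW, hOW, hwW⟩ := hw
  have hcomp : IsCompact (closure O) := hOb.isCompact_closure
  have hwO : ContDiffOn ℝ 1 w O := hwW.mono (subset_closure.trans hOW)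
  have hwc : ContinuousOn w (closure O) := hwW.continuousOn.mono hOW
  obtain ⟨B, hB⟩ := hcomp.exists_bound_of_continuousOn hwc
  obtain ⟨M, hM⟩ := hcomp.exists_bound_of_continuousOn
    ((hwW.continuousOn_fderiv_of_isOpen hW le_rfl).mono hOW)
  have hM' : ∀ x ∈ O, ‖gradient w x‖ ≤ M := fun x hx => by
    rw [gradient, LinearIsometryEquiv.norm_map]
    exact hM x (subset_closure hx)
  have hwm : AEMeasurable w (volume.restrict O) :=
    hwO.continuousOn.aemeasurable hO.measurableSet
  have hHC : ContDiff ℝ 1 H := by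
    refine contDiff_one_iff_deriv.2 ⟨fun t => (hH t).differentiableAt, ?_⟩
    rwa [funext fun t => (hH t).deriv]
  have hHm : AEMeasurable (fun x => H (w x)) (volume.restrict O) :=
    hHC.continuous.measurable.comp_aemeasurable hwm
  obtain ⟨h1, h2, h3⟩ := contDiff_indicator_comp hO hOb hwc hwO hwbd hε hHC hH0
  have hgrad : ∀ x ∈ O, gradient (O.indicator (H ∘ w)) x = D (w x) • gradient w x := fun x hx => by
    rw [← (hH (w x)).gradient_comp ((hwO.contDiffAt (hO.mem_nhds hx)).differentiableAt one_ne_zero),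
      gradient, gradient, Filter.EventuallyEq.fderiv_eq]
    filter_upwards [hO.mem_nhds hx] with y hy using indicator_of_mem hy _
  have hpoin := pLambda1_mul_le_of_contDiff (one_pos.trans hp) hO hOb h1 h2 h3
  have hpow : ∀ t : ℝ, |t| ^ (p - 2) * |t| = |t| ^ (p - 1) := fun t => by
    rcases eq_or_ne t 0 with rfl | ht
    · simp [Real.zero_rpow (sub_pos.2 hp).ne']
    · rw [← Real.rpow_add_one (abs_pos.2 ht).ne']
      congr 1
      ring
  have htest := hsol.integral_eq_of_contDiff hp hO hOb hM' (K := l * B ^ (p - 1))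
    (fun x hx => ?_) ?_ h1 h2 h3
  · have hint : ∀ f : EuclideanSpace ℝ (Fin N) → ℝ, AEMeasurable f (volume.restrict O) →
        ∀ C, (∀ x ∈ O, ‖f x‖ ≤ C) → IntegrableOn f O := fun f hf C hC =>
      IntegrableOn.of_bound hOb.measure_lt_top hf.aestronglyMeasurable C
        ((ae_restrict_iff' hO.measurableSet).2 (ae_of_all _ hC))
    calc pLambda1 p O * ∫ x in O, (H (w x)) ^ p
        = pLambda1 p O * ∫ x in O, |O.indicator (H ∘ w) x| ^ p := by
          congr 1
          refine setIntegral_congr_fun hO.measurableSet fun x hx => ?_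
          simp [indicator_of_mem hx, abs_of_nonneg (hHn _)]
      _ ≤ ∫ x in O, ‖gradient (O.indicator (H ∘ w)) x‖ ^ p := hpoin
      _ ≤ ∫ x in O, -(‖gradient w x‖ ^ (p - 2) *
            ⟪gradient w x, gradient (O.indicator (H ∘ w)) x⟫) := by
          have hpt : ∀ x ∈ O, -(‖gradient w x‖ ^ (p - 2) *
              ⟪gradient w x, gradient (O.indicator (H ∘ w)) x⟫) =
              -D (w x) * ‖gradient w x‖ ^ p := fun x hx => by
            rw [hgrad x hx, inner_smul_right, real_inner_self_eq_norm_sq]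
            rcases eq_or_ne (gradient w x) 0 with h0 | h0
            · simp [h0, Real.zero_rpow (one_pos.trans hp).ne']
            · have : ‖gradient w x‖ ^ p = ‖gradient w x‖ ^ (p - 2) * ‖gradient w x‖ ^ 2 := by
                rw [← Real.rpow_natCast, ← Real.rpow_add (norm_pos_iff.2 h0)]
                norm_num
              rw [this]
              ring
          refine setIntegral_mono_on ?_ ?_ hO.measurableSet fun x hx => ?_
          · refine hint _ ((measurable_gradient _).norm.pow_const p).aemeasurable (M ^ p)
              fun x hx => ?_
            rw [Real.norm_of_nonneg (by positivity), hgrad x hx, norm_smul]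
            refine Real.rpow_le_rpow (by positivity) ?_ (by linarith)
            have : ‖D (w x)‖ ≤ 1 := abs_le.2 ⟨(hD1 _).1, (hD1 _).2.trans zero_le_one⟩
            nlinarith [hM' x hx, norm_nonneg (gradient w x)]
          · refine hint _ ?_ (M ^ p) fun x hx => ?_
            · exact (((measurable_gradient w).norm.pow_const _).mul
                ((measurable_gradient w).inner (measurable_gradient _))).neg.aemeasurable
            · have hb := Real.rpow_le_rpow (norm_nonneg _) (hM' x hx) (one_pos.trans hp).le
              have h0 : 0 ≤ ‖gradient w x‖ ^ p := by positivity
              rw [hpt x hx, Real.norm_of_nonneg (mul_nonneg (neg_nonneg.2 (hD1 _).2) h0)]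
              nlinarith [hD1 (w x)]
          · rw [hpt x hx, hgrad x hx, norm_smul, Real.mul_rpow (norm_nonneg _) (norm_nonneg _),
              Real.norm_of_nonpos (hD1 _).2]
            gcongr
            calc (-D (w x)) ^ p ≤ (-D (w x)) ^ (1 : ℝ) :=
                  Real.rpow_le_rpow_of_exponent_ge' (by linarith [hD1 (w x)])
                    (by linarith [hD1 (w x)]) zero_le_one hp.le
              _ = -D (w x) := Real.rpow_one _
      _ = ∫ x in O, -(l * (|w x| ^ (p - 2) * w x) * O.indicator (H ∘ w) x) := by
          rw [integral_neg, htest, integral_neg]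
      _ ≤ ∫ x in O, l * (w x)⁻ ^ p := by
          have hpt : ∀ x ∈ O, -(l * (|w x| ^ (p - 2) * w x) * O.indicator (H ∘ w) x) =
              l * ((w x)⁻ ^ (p - 1) * H (w x)) := fun x hx => by
            rw [indicator_of_mem hx, Function.comp_apply]
            rcases le_total 0 (w x) with h0 | h0
            · simp [hH0 _ ((neg_nonpos.2 hε.le).trans h0)]
            · rw [negPart_eq_neg.2 h0, ← abs_of_nonpos h0, ← hpow (w x)]
              rw [show w x = -|w x| by rw [abs_of_nonpos h0, neg_neg]]
              simp only [abs_neg, abs_abs]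
              ring
          have hnB : ∀ x ∈ O, (w x)⁻ ≤ B := fun x hx =>
            (by rw [negPart_def]; exact max_le (neg_le_abs _) (abs_nonneg _) :
              (w x)⁻ ≤ |w x|).trans (hB x (subset_closure hx))
          have hnm : AEMeasurable (fun x => (w x)⁻) (volume.restrict O) := by
            simp only [negPart_def]
            exact hwm.neg.max aemeasurable_const
          have hpt2 : ∀ x, (w x)⁻ ^ (p - 1) * H (w x) ≤ (w x)⁻ ^ p := fun x => by
            have hn := negPart_nonneg (w x)
            calc (w x)⁻ ^ (p - 1) * H (w x) ≤ (w x)⁻ ^ (p - 1) * (w x)⁻ := by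
                  gcongr
                  exact hHle _
              _ = (w x)⁻ ^ p := by
                  rw [← abs_of_nonneg hn, ← hpow, abs_of_nonneg hn]
                  rcases hn.eq_or_lt with h | h
                  · simp [← h, Real.zero_rpow (one_pos.trans hp).ne']
                  · rw [← Real.rpow_add_one h.ne', ← Real.rpow_add_one h.ne']
                    congr 1
                    ring
          have hpt3 : ∀ x ∈ O, (w x)⁻ ^ p ≤ B ^ p := fun x hx =>
            Real.rpow_le_rpow (negPart_nonneg _) (hnB x hx) (one_pos.trans hp).le
          have hnn : ∀ x, 0 ≤ (w x)⁻ ^ (p - 1) * H (w x) := fun x =>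
            mul_nonneg (Real.rpow_nonneg (negPart_nonneg _) _) (hHn _)
          rw [setIntegral_congr_fun hO.measurableSet hpt]
          refine setIntegral_mono_on ((hint _ ((hnm.pow_const _).mul hHm) (B ^ p) ?_).const_mul _)
            ((hint _ (hnm.pow_const _) (B ^ p) ?_).const_mul _) hO.measurableSet fun x hx => ?_
          · intro x hx
            rw [Pi.mul_apply, Real.norm_of_nonneg (hnn x)]
            exact (hpt2 x).trans (hpt3 x hx)
          · intro x hx
            rw [Real.norm_of_nonneg (Real.rpow_nonneg (negPart_nonneg _) _)]
            exact hpt3 x hx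
          · exact mul_le_mul_of_nonneg_left (hpt2 x) hl
      _ = l * ∫ x in O, (w x)⁻ ^ p := integral_const_mul _ _
  · rw [abs_mul, abs_mul, abs_of_nonneg hl, abs_of_nonneg (by positivity), hpow]
    have := Real.rpow_le_rpow (abs_nonneg _) (hB x (subset_closure hx)) (sub_pos.2 hp).le
    exact mul_le_mul_of_nonneg_left this hl
  · exact (((hwm.norm.pow_const _).mul hwm).const_mul l).aestronglyMeasurable

end

/-- Nonnegativity part of Proposition 4.1: a weak solution of
`-Δ_p w = λ₁(Ω) |w|^{p-2} w` on `O ⊆ Ω` with `λ₁(Ω) < λ₁(O)` and `w ≥ 0` on `∂O`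
is nonnegative throughout `O`. -/
theorem nonneg_of_weakSolution_eigen_rhs
    (N : ℕ) (p : ℝ) (hp : 1 < p) (Ω O : Set (EuclideanSpace ℝ (Fin N)))
    (hΩo : IsOpen Ω) (hΩconn : IsConnected Ω) (hΩbdd : Bornology.IsBounded Ω)
    (hOo : IsOpen O) (hOsub : O ⊆ Ω)
    (hlam : pLambda1 p Ω < pLambda1 p O)
    (w : EuclideanSpace ℝ (Fin N) → ℝ)
    (hw1 : C1OnClosure O w)
    (hwbd : ∀ x ∈ frontier O, 0 ≤ w x)
    (hwsol : IsWeakSolution p O w (fun x => pLambda1 p Ω * (|w x| ^ (p - 2) * w x))) :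
    ∀ x ∈ O, 0 ≤ w x := by
  have hOb : Bornology.IsBounded O := hΩbdd.subset hOsub
  have hl := pLambda1_nonneg p Ω
  have hp0 : 0 < p := one_pos.trans hp
  have hwc : ContinuousOn w (closure O) := by
    obtain ⟨W, -, hOW, hwW⟩ := hw1
    exact hwW.continuousOn.mono hOW
  obtain ⟨B, hB⟩ := hOb.isCompact_closure.exists_bound_of_continuousOn hwc
  have hcont : ContinuousOn (fun x => (w x)⁻ ^ p) O := by
    simp only [negPart_def]
    exact ((hwc.mono subset_closure).neg.sup continuousOn_const).rpow_const
      fun _ _ => Or.inr hp0.le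
  have hnB : ∀ x ∈ O, (w x)⁻ ≤ B := fun x hx =>
    (by rw [negPart_def]; exact max_le (neg_le_abs _) (abs_nonneg _) :
      (w x)⁻ ≤ |w x|).trans (hB x (subset_closure hx))
  have hnn : ∀ x, 0 ≤ (w x)⁻ ^ p := fun x => Real.rpow_nonneg (negPart_nonneg _) _
  have hnp : ∀ x ∈ O, (w x)⁻ ^ p ≤ B ^ p := fun x hx =>
    Real.rpow_le_rpow (negPart_nonneg _) (hnB x hx) hp0.le
  choose H D hH hD hD1 hHn hH0 hHle hHge using fun n : ℕ =>
    exists_smooth_negPart_approx (Nat.one_div_pos_of_nat (α := ℝ) (n := n))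
  have hlim : Filter.Tendsto (fun n => ∫ x in O, (H n (w x)) ^ p) Filter.atTop
      (nhds (∫ x in O, (w x)⁻ ^ p)) := by
    refine tendsto_setIntegral_of_forall_norm_le hOo hOb (B ^ p) (fun n => ?_) (fun n x hx => ?_)
      fun x _ => Filter.Tendsto.rpow_const ?_ (Or.inr hp0.le)
    · have hHc : Continuous (H n) := continuous_iff_continuousAt.2 fun t => (hH n t).continuousAt
      exact ((hHc.comp_continuousOn (hwc.mono subset_closure)).rpow_const
        fun _ _ => Or.inr hp0.le).aestronglyMeasurable hOo.measurableSet
    · rw [Real.norm_of_nonneg (Real.rpow_nonneg (hHn _ _) _)]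
      exact Real.rpow_le_rpow (hHn _ _) ((hHle _ _).trans (hnB x hx)) hp0.le
    · refine tendsto_of_tendsto_of_tendsto_of_le_of_le ?_ tendsto_const_nhds
        (fun n => hHge n (w x)) fun n => hHle n (w x)
      simpa using (tendsto_one_div_add_atTop_nhds_zero_nat (𝕜 := ℝ)).const_mul 2 |>.const_sub (w x)⁻
  have hle : pLambda1 p O * ∫ x in O, (w x)⁻ ^ p ≤ pLambda1 p Ω * ∫ x in O, (w x)⁻ ^ p :=
    le_of_tendsto' (hlim.const_mul _) fun n =>
      pLambda1_mul_integral_truncation_le hp hOo hOb hw1 hwbd hl hwsol Nat.one_div_pos_of_nat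
        (hH n) (hD n) (hD1 n) (hHn n) (hH0 n) (hHle n)
  have hzero : ∫ x in O, (w x)⁻ ^ p = 0 := by
    have : 0 ≤ ∫ x in O, (w x)⁻ ^ p := integral_nonneg hnn
    nlinarith
  have hint : IntegrableOn (fun x => (w x)⁻ ^ p) O := by
    refine IntegrableOn.of_bound hOb.measure_lt_top
      (hcont.aestronglyMeasurable hOo.measurableSet) (B ^ p)
      ((ae_restrict_iff' hOo.measurableSet).2 (ae_of_all _ fun x hx => ?_))
    rw [Real.norm_of_nonneg (hnn x)]
    exact hnp x hx
  have hae := (integral_eq_zero_iff_of_nonneg hnn hint).1 hzero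
  intro x hx
  have h0 := Measure.eqOn_open_of_ae_eq hae hOo hcont continuousOn_const hx
  exact negPart_eq_zero.1 ((Real.rpow_eq_zero (negPart_nonneg _) hp0.ne').1 h0)

end
end

section
/- (Uniqueness part of Proposition 4.1, Lindqvist-type uniqueness.) Let 1 < p < ∞, let O ⊂ ℝ^N be a bounded domain and let λ > 0. Suppose u and v are C^1 on the closure of O, strictly positive on the closure of O, both weak solutions of −Δ_p w = λ w^{p−1} in O, and u = v on ∂O. Then u = v throughout O. -/
open MeasureTheory RealInnerProductSpace Metric Set

noncomputable section

/-- The tangent-line remainder of `‖·‖ ^ p` at `b`, evaluated at `a`. -/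
def normPowRemainder {E : Type*} [NormedAddCommGroup E] [InnerProductSpace ℝ E]
    (p : ℝ) (a b : E) : ℝ :=
  ‖a‖ ^ (p - 2) * ⟪a, a⟫ - ‖b‖ ^ (p - 2) * ⟪b, b⟫ - p * (‖b‖ ^ (p - 2) * ⟪b, a - b⟫)

lemma norm_rpow_sub_two_mul_inner_self {E : Type*} [NormedAddCommGroup E] [InnerProductSpace ℝ E]
    {p : ℝ} (hp : 1 < p) (a : E) : ‖a‖ ^ (p - 2) * ⟪a, a⟫ = ‖a‖ ^ p := by
  rcases eq_or_ne a 0 with rfl | ha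
  · simp [Real.zero_rpow (by linarith : p ≠ 0)]
  · rw [real_inner_self_eq_norm_sq, ← Real.rpow_natCast, ← Real.rpow_add (norm_pos_iff.2 ha)]
    norm_num

lemma normPowRemainder_pos {E : Type*} [NormedAddCommGroup E] [InnerProductSpace ℝ E]
    {p : ℝ} (hp : 1 < p) {a b : E} (hab : a ≠ b) : 0 < normPowRemainder p a b := by
  unfold normPowRemainder
  rcases eq_or_ne b 0 with rfl | hb
  · have ha : 0 < ‖a‖ := norm_pos_iff.2 hab
    rw [norm_rpow_sub_two_mul_inner_self hp]
    simpa using Real.rpow_pos_of_pos ha p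
  have hb' : 0 < ‖b‖ := norm_pos_iff.2 hb
  have hc : 0 < ‖b‖ ^ (p - 2) := Real.rpow_pos_of_pos hb' _
  have hbp : ‖b‖ ^ p = ‖b‖ ^ (p - 2) * ‖b‖ ^ 2 := by
    rw [← norm_rpow_sub_two_mul_inner_self hp, real_inner_self_eq_norm_sq]
  rw [norm_rpow_sub_two_mul_inner_self hp a, inner_sub_right, real_inner_self_eq_norm_sq]
  have hratio : (1 + (‖a‖ / ‖b‖ - 1)) ^ p * ‖b‖ ^ p = ‖a‖ ^ p := by
    rw [← Real.mul_rpow (by simp; positivity) hb'.le]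
    congr 1
    field_simp
    ring
  have hlin : (1 + p * (‖a‖ / ‖b‖ - 1)) * ‖b‖ ^ p
      = ‖b‖ ^ (p - 2) * (‖b‖ ^ 2 + p * (‖a‖ * ‖b‖ - ‖b‖ ^ 2)) := by
    rw [hbp]
    field_simp
  have hs : -1 ≤ ‖a‖ / ‖b‖ - 1 := by
    have : 0 ≤ ‖a‖ / ‖b‖ := by positivity
    linarith
  have hcs := real_inner_le_norm b a
  have hcp : 0 < p * ‖b‖ ^ (p - 2) := by positivity
  rcases eq_or_ne (‖a‖ / ‖b‖ - 1) 0 with h0 | h0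
  · have hnorm : ‖a‖ = ‖b‖ := by
      field_simp at h0
      linarith
    have hlt : ⟪b, a⟫ < ‖b‖ * ‖a‖ := by
      refine lt_of_le_of_ne hcs fun h => hab ?_
      rw [inner_eq_norm_mul_iff_real, hnorm] at h
      exact (smul_right_injective E hb'.ne' h).symm
    rw [hnorm] at hlt ⊢
    rw [hbp]
    nlinarith [mul_pos hcp (sub_pos.2 hlt)]
  · have hB := mul_lt_mul_of_pos_right (one_add_mul_self_lt_rpow_one_add hs h0 hp)
      (Real.rpow_pos_of_pos hb' p)
    rw [hratio, hlin] at hB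
    nlinarith [mul_le_mul_of_nonneg_left hcs hcp.le]

lemma normPowRemainder_nonneg {E : Type*} [NormedAddCommGroup E] [InnerProductSpace ℝ E]
    {p : ℝ} (hp : 1 < p) (a b : E) : 0 ≤ normPowRemainder p a b := by
  rcases eq_or_ne a b with rfl | hab
  · simp [normPowRemainder]
  · exact (normPowRemainder_pos hp hab).le

lemma continuous_norm_rpow_sub_two_smul {E : Type*} [NormedAddCommGroup E] [NormedSpace ℝ E]
    {p : ℝ} (hp : 1 < p) : Continuous fun x : E => ‖x‖ ^ (p - 2) • x := by
  refine continuous_iff_continuousAt.2 fun x => ?_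
  rcases eq_or_ne x 0 with rfl | hx
  · have hlim : Filter.Tendsto (fun x : E => ‖x‖ ^ (p - 1)) (nhds 0) (nhds 0) := by
      have : Continuous fun x : E => ‖x‖ ^ (p - 1) :=
        continuous_norm.rpow_const fun _ => Or.inr (by linarith)
      simpa [Real.zero_rpow (by linarith : p - 1 ≠ 0)] using this.tendsto 0
    rw [ContinuousAt, smul_zero]
    refine squeeze_zero_norm (fun y => ?_) hlim
    rcases eq_or_ne y 0 with rfl | hy
    · simp [Real.zero_rpow (by linarith : p - 1 ≠ 0)]
    · rw [norm_smul, Real.norm_of_nonneg (by positivity),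
        ← Real.rpow_add_one (norm_ne_zero_iff.2 hy)]
      exact le_of_eq (by ring_nf)
  · exact (continuousAt_id.norm.rpow_const (Or.inl (norm_ne_zero_iff.2 hx))).smul continuousAt_id

lemma tendsto_setIntegral_clm_mollify {N : ℕ} {E' : Type*} [NormedAddCommGroup E']
    [NormedSpace ℝ E'] [CompleteSpace E'] {O : Set (EuclideanSpace ℝ (Fin N))}
    (hO : IsOpen O) {Y : EuclideanSpace ℝ (Fin N) → E' →L[ℝ] ℝ} (hY : ContinuousOn Y O)
    {g : EuclideanSpace ℝ (Fin N) → E'} (hg : Continuous g) {K : Set (EuclideanSpace ℝ (Fin N))}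
    (hgc : HasCompactSupport g) {δ : ℝ} (hKO : cthickening δ K ⊆ O) (hK : IsCompact K)
    (hgK : tsupport g ⊆ K)
    {ρ : ℕ → ContDiffBump (0 : EuclideanSpace ℝ (Fin N))}
    (hρ : Filter.Tendsto (fun n => (ρ n).rOut) Filter.atTop (nhds 0)) (hρδ : ∀ n, (ρ n).rOut ≤ δ) :
    Filter.Tendsto (fun n => ∫ x in O, Y x
      (convolution ((ρ n).normed volume) g (ContinuousLinearMap.lsmul ℝ ℝ) volume x))
      Filter.atTop (nhds (∫ x in O, Y x (g x))) := by
  obtain ⟨C, hC⟩ := hg.bounded_above_of_compact_support hgc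
  have hcomp : IsCompact (cthickening δ K) := hK.cthickening
  have hmeas : ∀ n, AEStronglyMeasurable (fun x => Y x
      (convolution ((ρ n).normed volume) g (ContinuousLinearMap.lsmul ℝ ℝ) volume x))
      (volume.restrict O) := fun n => by
    have hcont : Continuous
        (convolution ((ρ n).normed volume) g (ContinuousLinearMap.lsmul ℝ ℝ) volume) :=
      (ρ n).hasCompactSupport_normed.continuous_convolution_left _ (ρ n).continuous_normed
        hg.locallyIntegrable
    exact (hY.clm_apply hcont.continuousOn).aestronglyMeasurable hO.measurableSet
  refine tendsto_integral_of_dominated_convergence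
    ((cthickening δ K).indicator fun x => ‖Y x‖ * (2 * C + C)) hmeas ?_ ?_ ?_
  · refine Integrable.mono_measure ?_ Measure.restrict_le_self
    rw [integrable_indicator_iff hcomp.measurableSet]
    exact ((hY.mono hKO).norm.mul continuousOn_const).integrableOn_compact hcomp
  · refine fun n => Filter.Eventually.of_forall fun x => ?_
    by_cases hx : x ∈ cthickening δ K
    · rw [indicator_of_mem hx]
      refine (Y x).le_opNorm_of_le ?_
      have hd := (ρ n).dist_normed_convolution_le (μ := volume) (g := g) (x₀ := x) (ε := 2 * C)
        hg.aestronglyMeasurable fun y _ => by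
          rw [dist_eq_norm]
          linarith [norm_sub_le (g y) (g x), hC x, hC y]
      rw [dist_eq_norm] at hd
      linarith [norm_le_norm_sub_add
        (convolution ((ρ n).normed volume) g (ContinuousLinearMap.lsmul ℝ ℝ) volume x) (g x), hC x]
    · have hz : ∀ y ∈ ball x (ρ n).rOut, g y = 0 := fun y hy => by
        by_contra hne
        refine hx (mem_cthickening_of_dist_le x y δ K (hgK (subset_tsupport g hne)) ?_)
        rw [dist_comm]
        exact (mem_ball.1 hy).le.trans (hρδ n)
      rw [(ρ n).normed_convolution_eq_right fun y hy => by
        rw [hz y hy, hz x (mem_ball_self (ρ n).rOut_pos)], hz x (mem_ball_self (ρ n).rOut_pos),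
        indicator_of_notMem hx]
      simp
  · exact Filter.Eventually.of_forall fun x => ((Y x).continuous.tendsto _).comp
      (ContDiffBump.convolution_tendsto_right_of_continuous hρ hg x)

/-- A distributional identity `-div X = h` extends from smooth to `C^1` test functions. -/
lemma setIntegral_inner_gradient_eq_of_isTestFun {N : ℕ} {O : Set (EuclideanSpace ℝ (Fin N))}
    (hO : IsOpen O) {X : EuclideanSpace ℝ (Fin N) → EuclideanSpace ℝ (Fin N)}
    {h : EuclideanSpace ℝ (Fin N) → ℝ} (hX : ContinuousOn X O) (hh : ContinuousOn h O)
    (hweak : ∀ φ, IsTestFun O φ → ∫ x in O, ⟪X x, gradient φ x⟫ = ∫ x in O, h x * φ x)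
    {φ : EuclideanSpace ℝ (Fin N) → ℝ} (hφ : ContDiff ℝ 1 φ) (hφc : HasCompactSupport φ)
    (hφO : tsupport φ ⊆ O) :
    ∫ x in O, ⟪X x, gradient φ x⟫ = ∫ x in O, h x * φ x := by
  obtain ⟨δ, hδ, hδO⟩ := hφc.isCompact.exists_cthickening_subset_open hO hφO
  let ρ : ℕ → ContDiffBump (0 : EuclideanSpace ℝ (Fin N)) := fun n =>
    { rIn := δ / (n + 1) / 2
      rOut := δ / (n + 1)
      rIn_pos := by positivity
      rIn_lt_rOut := half_lt_self (by positivity) }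
  have hρ : Filter.Tendsto (fun n => (ρ n).rOut) Filter.atTop (nhds 0) := by
    simpa [ρ, div_eq_mul_inv] using
      (tendsto_one_div_add_atTop_nhds_zero_nat (𝕜 := ℝ)).const_mul δ
  have hρδ : ∀ n, (ρ n).rOut ≤ δ := fun n =>
    div_le_self hδ.le (by linarith [n.cast_nonneg (α := ℝ)])
  let ψ : ℕ → EuclideanSpace ℝ (Fin N) → ℝ := fun n =>
    convolution ((ρ n).normed volume) φ (ContinuousLinearMap.lsmul ℝ ℝ) volume
  have hψ : ∀ n, IsTestFun O (ψ n) := fun n => by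
    have hsub : tsupport (ψ n) ⊆ cthickening δ (tsupport φ) := by
      refine closure_minimal (fun x hx => ?_) isClosed_cthickening
      by_contra hxn
      have hz : ∀ y ∈ ball x (ρ n).rOut, φ y = 0 := fun y hy => by
        by_contra hne
        refine hxn (mem_cthickening_of_dist_le x y δ _ (subset_tsupport φ hne) ?_)
        rw [dist_comm]
        exact (mem_ball.1 hy).le.trans (hρδ n)
      refine hx ?_
      change convolution _ _ _ _ _ = _
      rw [(ρ n).normed_convolution_eq_right fun y hy => by
        rw [hz y hy, hz x (mem_ball_self (ρ n).rOut_pos)], hz x (mem_ball_self (ρ n).rOut_pos)]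
    exact ⟨(ρ n).hasCompactSupport_normed.contDiff_convolution_left _ (ρ n).contDiff_normed
      hφ.continuous.locallyIntegrable,
      hφc.isCompact.cthickening.of_isClosed_subset (isClosed_tsupport _) hsub, hsub.trans hδO⟩
  have hgrad : ∀ (f : EuclideanSpace ℝ (Fin N) → ℝ) x, ⟪X x, gradient f x⟫ = fderiv ℝ f x (X x) :=
    fun f x => by
      rw [real_inner_comm, gradient, InnerProductSpace.toDual_symm_apply]
  have hder : ∀ n x, fderiv ℝ (ψ n) x = convolution ((ρ n).normed volume) (fderiv ℝ φ)
      (ContinuousLinearMap.lsmul ℝ ℝ) volume x := fun n x =>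
    (hφc.hasFDerivAt_convolution_right (ContinuousLinearMap.lsmul ℝ ℝ)
      (ρ n).continuous_normed.locallyIntegrable hφ x).fderiv
  have h1 := tendsto_setIntegral_clm_mollify hO
    (Y := fun x => ContinuousLinearMap.apply ℝ ℝ (X x))
    ((ContinuousLinearMap.apply ℝ ℝ).continuous.comp_continuousOn hX)
    (hφ.continuous_fderiv one_ne_zero) (hφc.fderiv ℝ) hδO hφc.isCompact
    (tsupport_fderiv_subset ℝ) hρ hρδ
  have h2 := tendsto_setIntegral_clm_mollify hO
    (Y := fun x => ContinuousLinearMap.lsmul ℝ ℝ (h x))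
    ((ContinuousLinearMap.lsmul ℝ ℝ).continuous.comp_continuousOn hh)
    hφ.continuous hφc hδO hφc.isCompact subset_rfl hρ hρδ
  simp only [ContinuousLinearMap.apply_apply, ← hder, ← hgrad] at h1
  simp only [ContinuousLinearMap.lsmul_apply, smul_eq_mul] at h2
  exact tendsto_nhds_unique (h1.congr fun n => hweak _ (hψ n)) h2

lemma contDiff_of_contDiffAt_tsupport {E : Type*} [NormedAddCommGroup E] [NormedSpace ℝ E]
    {f : E → ℝ} {n : WithTop ℕ∞} (hf : ∀ x ∈ tsupport f, ContDiffAt ℝ n f x) : ContDiff ℝ n f := by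
  refine contDiff_iff_contDiffAt.2 fun x => ?_
  by_cases hx : x ∈ tsupport f
  · exact hf x hx
  · exact contDiffAt_const.congr_of_eventuallyEq (notMem_tsupport_iff_eventuallyEq.1 hx)

lemma hasDerivAt_max_zero_sq (t : ℝ) :
    HasDerivAt (fun t : ℝ => max t 0 ^ 2) (2 * max t 0) t := by
  rcases lt_trichotomy t 0 with ht | rfl | ht
  · rw [max_eq_right ht.le, mul_zero]
    refine (hasDerivAt_const t (0 : ℝ)).congr_of_eventuallyEq ?_
    filter_upwards [Iio_mem_nhds ht] with s hs
    simp [max_eq_right (mem_Iio.1 hs).le]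
  · rw [hasDerivAt_iff_isLittleO_nhds_zero]
    have hle : (fun h : ℝ => max h 0 ^ 2) =O[nhds 0] fun h => h ^ 2 := by
      refine Asymptotics.isBigO_of_le _ fun h => ?_
      rcases le_total h 0 with hh | hh <;> simp [hh, sq_nonneg]
    simpa using hle.trans_isLittleO (Asymptotics.isLittleO_pow_id one_lt_two)
  · rw [max_eq_left ht.le]
    have := hasDerivAt_pow 2 t
    refine HasDerivAt.congr_of_eventuallyEq (by simpa using this) ?_
    filter_upwards [Ioi_mem_nhds ht] with s hs
    simp [max_eq_left (mem_Ioi.1 hs).le]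

lemma contDiff_max_zero_sq : ContDiff ℝ 1 fun t : ℝ => max t 0 ^ 2 := by
  refine contDiff_one_iff_deriv.2 ⟨fun t => (hasDerivAt_max_zero_sq t).differentiableAt, ?_⟩
  rw [funext fun t => (hasDerivAt_max_zero_sq t).deriv]
  fun_prop

/-- Testing `-Δ_p w = λ w^{p-1}` against `w^{1-p} F`. -/
lemma IsWeakSolution.test_rpow_mul {N : ℕ} {p lam : ℝ} (hp : 1 < p)
    {O : Set (EuclideanSpace ℝ (Fin N))} (hO : IsOpen O) {w : EuclideanSpace ℝ (Fin N) → ℝ}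
    (hw : ContDiffOn ℝ 1 w O) (hpos : ∀ x ∈ O, 0 < w x)
    (hsol : IsWeakSolution p O w fun x => lam * w x ^ (p - 1))
    {F : EuclideanSpace ℝ (Fin N) → ℝ} (hF : ContDiff ℝ 1 F) (hFc : HasCompactSupport F)
    (hFO : tsupport F ⊆ O) {Q : EuclideanSpace ℝ (Fin N) → ℝ}
    (hQ : ∀ x, Q x = ‖(w x)⁻¹ • gradient w x‖ ^ (p - 2) *
      (⟪(w x)⁻¹ • gradient w x, gradient F x⟫ +
        (1 - p) * F x * ⟪(w x)⁻¹ • gradient w x, (w x)⁻¹ • gradient w x⟫)) :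
    ContinuousOn Q O ∧ IntegrableOn Q O ∧ ∫ x in O, Q x = lam * ∫ x in O, F x := by
  have hwd : ∀ x ∈ O, HasGradientAt w (gradient w x) x := fun x hx =>
    ((hw.contDiffAt (hO.mem_nhds hx)).differentiableAt one_ne_zero).hasGradientAt
  have hgw : ContinuousOn (gradient w) O :=
    (InnerProductSpace.toDual ℝ _).symm.continuous.comp_continuousOn
      (hw.continuousOn_fderiv_of_isOpen hO le_rfl)
  set φ : EuclideanSpace ℝ (Fin N) → ℝ := fun y => w y ^ (1 - p) * F y with hφdef
  have hφF : tsupport φ ⊆ tsupport F := tsupport_mul_subset_right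
  have hφ : ContDiff ℝ 1 φ := contDiff_of_contDiffAt_tsupport fun x hx =>
    ((hw.contDiffAt (hO.mem_nhds (hFO (hφF hx)))).rpow_const_of_ne
      (hpos x (hFO (hφF hx))).ne').mul hF.contDiffAt
  have hφc : HasCompactSupport φ := hFc.mul_left
  have hgφ : ∀ x ∈ O, gradient φ x =
      w x ^ (1 - p) • gradient F x + (F x * ((1 - p) * w x ^ (-p))) • gradient w x := fun x hx => by
    have h1 := (hwd x hx).hasFDerivAt.rpow_const (p := 1 - p) (Or.inl (hpos x hx).ne')
    have h2 := (hF.differentiable one_ne_zero x).hasGradientAt.hasFDerivAt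
    refine HasGradientAt.gradient (hasGradientAt_iff_hasFDerivAt.2 ((h1.mul h2).congr_fderiv ?_))
    rw [show 1 - p - 1 = -p by ring]
    simp only [map_add, map_smul, smul_smul]
  have hX : ContinuousOn (fun x => ‖gradient w x‖ ^ (p - 2) • gradient w x) O :=
    (continuous_norm_rpow_sub_two_smul hp).comp_continuousOn hgw
  have hh : ContinuousOn (fun x => lam * w x ^ (p - 1)) O :=
    continuousOn_const.mul (hw.continuousOn.rpow_const fun x hx => Or.inl (hpos x hx).ne')
  have hid := setIntegral_inner_gradient_eq_of_isTestFun hO hX hh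
    (fun ψ hψ => by simpa only [real_inner_smul_left] using hsol ψ hψ) hφ hφc (hφF.trans hFO)
  have hEq : EqOn (fun x => ⟪‖gradient w x‖ ^ (p - 2) • gradient w x, gradient φ x⟫) Q O :=
    fun x hx => by
      have hw0 := hpos x hx
      obtain ⟨a, ha⟩ : ∃ a, a = (w x)⁻¹ • gradient w x := ⟨_, rfl⟩
      have hg : gradient w x = w x • a := by rw [ha, smul_inv_smul₀ hw0.ne']
      have e1 : w x ^ (p - 2) * w x * w x ^ (1 - p) = 1 := by
        rw [← Real.rpow_add_one hw0.ne', ← Real.rpow_add hw0,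
          show p - 2 + 1 + (1 - p) = 0 by ring, Real.rpow_zero]
      have e2 : w x ^ (p - 2) * w x * (w x ^ (-p) * w x) = 1 := by
        rw [← Real.rpow_add_one hw0.ne', ← Real.rpow_add_one hw0.ne', ← Real.rpow_add hw0,
          show p - 2 + 1 + (-p + 1) = 0 by ring, Real.rpow_zero]
      simp only [hQ, hgφ x hx]
      rw [← ha, hg, norm_smul, Real.norm_of_nonneg hw0.le,
        Real.mul_rpow hw0.le (norm_nonneg a)]
      simp only [inner_add_right, real_inner_smul_left, real_inner_smul_right]
      linear_combination (‖a‖ ^ (p - 2) * ⟪a, gradient F x⟫) * e1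
        + (‖a‖ ^ (p - 2) * F x * (1 - p) * ⟪a, a⟫) * e2
  have hcont : ContinuousOn
      (fun x => ⟪‖gradient w x‖ ^ (p - 2) • gradient w x, gradient φ x⟫) O :=
    hX.inner ((InnerProductSpace.toDual ℝ _).symm.continuous.comp
      (hφ.continuous_fderiv one_ne_zero)).continuousOn
  have hsupp : tsupport (fun x => ⟪‖gradient w x‖ ^ (p - 2) • gradient w x, gradient φ x⟫)
      ⊆ tsupport φ := by
    refine closure_minimal (fun x hx => ?_) (isClosed_tsupport _)
    refine tsupport_fderiv_subset ℝ (subset_tsupport _ fun h0 => hx ?_)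
    simp [gradient, h0]
  have hcont' := continuous_of_tsupport fun x hx =>
    hcont.continuousAt (hO.mem_nhds (hFO (hφF (hsupp hx))))
  have hint := hcont'.integrable_of_hasCompactSupport (μ := volume)
    (hφc.isCompact.of_isClosed_subset (isClosed_tsupport _) hsupp)
  refine ⟨hcont.congr hEq.symm, (hint.integrableOn (s := O)).congr_fun hEq hO.measurableSet, ?_⟩
  rw [← setIntegral_congr_fun hO.measurableSet hEq, hid, ← integral_const_mul]
  refine setIntegral_congr_fun hO.measurableSet fun x hx => ?_
  have : w x ^ (p - 1) * w x ^ (1 - p) = 1 := by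
    rw [← Real.rpow_add (hpos x hx)]
    norm_num
  simp only [hφdef]
  linear_combination lam * F x * this

/-- Two positive solutions agreeing on the boundary have equal logarithmic gradients where the
first one is larger. -/
lemma inv_smul_gradient_eq_of_lt {N : ℕ} {p lam : ℝ} (hp : 1 < p)
    {O : Set (EuclideanSpace ℝ (Fin N))} (hO : IsOpen O) (hObdd : Bornology.IsBounded O)
    {u v : EuclideanSpace ℝ (Fin N) → ℝ}
    (hu : ContDiffOn ℝ 1 u O) (hv : ContDiffOn ℝ 1 v O)
    (huc : ContinuousOn u (closure O)) (hvc : ContinuousOn v (closure O))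
    (hupos : ∀ x ∈ closure O, 0 < u x) (hvpos : ∀ x ∈ closure O, 0 < v x)
    (husol : IsWeakSolution p O u (fun x => lam * u x ^ (p - 1)))
    (hvsol : IsWeakSolution p O v (fun x => lam * v x ^ (p - 1)))
    (hbdry : ∀ x ∈ frontier O, u x = v x) {x : EuclideanSpace ℝ (Fin N)} (hx : x ∈ O)
    (hlt : v x < u x) : (u x)⁻¹ • gradient u x = (v x)⁻¹ • gradient v x := by
  have hupos' : ∀ y ∈ O, 0 < u y := fun y hy => hupos y (subset_closure hy)
  have hvpos' : ∀ y ∈ O, 0 < v y := fun y hy => hvpos y (subset_closure hy)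
  obtain ⟨ε, hε, hεx⟩ := exists_between
    (sub_pos.2 (Real.log_lt_log (hvpos' x hx) hlt))
  set m : EuclideanSpace ℝ (Fin N) → ℝ := fun y => max (Real.log (u y) - Real.log (v y) - ε) 0
    with hm
  set G : EuclideanSpace ℝ (Fin N) → ℝ := fun y => (u y ^ p - v y ^ p) * m y ^ 2 with hG
  set F := O.indicator G with hFdef
  set K := {y ∈ closure O | ε ≤ Real.log (u y) - Real.log (v y)}
  have hK : IsCompact K := by
    refine hObdd.isCompact_closure.of_isClosed_subset ?_ fun y hy => hy.1
    exact isClosed_closure.isClosed_le continuousOn_const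
      ((huc.log fun y hy => (hupos y hy).ne').sub (hvc.log fun y hy => (hvpos y hy).ne'))
  have hKO : K ⊆ O := fun y hy => by
    by_contra hyO
    have := hy.2
    rw [hbdry y ⟨hy.1, fun h => hyO (interior_subset h)⟩] at this
    linarith
  have hFK : tsupport F ⊆ K := by
    refine closure_minimal (fun y hy => ?_) hK.isClosed
    by_cases hyO : y ∈ O
    · refine ⟨subset_closure hyO, ?_⟩
      by_contra hlt
      refine hy ?_
      rw [hFdef, indicator_of_mem hyO, hG]
      simp [hm, max_eq_right (show Real.log (u y) - Real.log (v y) - ε ≤ 0 by linarith)]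
    · exact absurd (indicator_of_notMem hyO _) hy
  have hFG : ∀ y ∈ O, F =ᶠ[nhds y] G := fun y hy => by
    filter_upwards [hO.mem_nhds hy] with z hz using indicator_of_mem hz _
  have hF : ContDiff ℝ 1 F := contDiff_of_contDiffAt_tsupport fun y hy => by
    have hyO := hKO (hFK hy)
    have hu' := hu.contDiffAt (hO.mem_nhds hyO)
    have hv' := hv.contDiffAt (hO.mem_nhds hyO)
    have hu0 := (hupos' y hyO).ne'
    have hv0 := (hvpos' y hyO).ne'
    refine ContDiffAt.congr_of_eventuallyEq ?_ (hFG y hyO)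
    exact ((hu'.rpow_const_of_ne hu0).sub (hv'.rpow_const_of_ne hv0)).mul
      (contDiff_max_zero_sq.contDiffAt.comp y (((hu'.log hu0).sub (hv'.log hv0)).sub
        contDiffAt_const))
  have hFc : HasCompactSupport F := hK.of_isClosed_subset (isClosed_tsupport _) hFK
  obtain ⟨cu, iu, eu⟩ := husol.test_rpow_mul hp hO hu hupos' hF hFc (hFK.trans hKO) fun _ => rfl
  obtain ⟨cv, iv, ev⟩ := hvsol.test_rpow_mul hp hO hv hvpos' hF hFc (hFK.trans hKO) fun _ => rfl
  set Qu : EuclideanSpace ℝ (Fin N) → ℝ := fun x => ‖(u x)⁻¹ • gradient u x‖ ^ (p - 2) *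
      (⟪(u x)⁻¹ • gradient u x, gradient F x⟫ +
        (1 - p) * F x * ⟪(u x)⁻¹ • gradient u x, (u x)⁻¹ • gradient u x⟫)
  set Qv : EuclideanSpace ℝ (Fin N) → ℝ := fun x => ‖(v x)⁻¹ • gradient v x‖ ^ (p - 2) *
      (⟪(v x)⁻¹ • gradient v x, gradient F x⟫ +
        (1 - p) * F x * ⟪(v x)⁻¹ • gradient v x, (v x)⁻¹ • gradient v x⟫)
  have hzero : ∫ y in O, (Qu y - Qv y) = 0 := by rw [integral_sub iu iv, eu, ev, sub_self]
  have hkey : ∀ y ∈ O, Qu y - Qv y =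
      (m y ^ 2 * u y ^ p + (u y ^ p - v y ^ p) * (2 * m y) / p) *
        normPowRemainder p ((u y)⁻¹ • gradient u y) ((v y)⁻¹ • gradient v y) +
      (m y ^ 2 * v y ^ p + (u y ^ p - v y ^ p) * (2 * m y) / p) *
        normPowRemainder p ((v y)⁻¹ • gradient v y) ((u y)⁻¹ • gradient u y) := fun y hy => by
    have hu0 := hupos' y hy
    have hv0 := hvpos' y hy
    obtain ⟨a, ha⟩ : ∃ a, a = (u y)⁻¹ • gradient u y := ⟨_, rfl⟩
    obtain ⟨b, hb⟩ : ∃ b, b = (v y)⁻¹ • gradient v y := ⟨_, rfl⟩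
    have hgu : gradient u y = u y • a := by rw [ha, smul_inv_smul₀ hu0.ne']
    have hgv : gradient v y = v y • b := by rw [hb, smul_inv_smul₀ hv0.ne']
    have du := ((hu.contDiffAt (hO.mem_nhds hy)).differentiableAt
      one_ne_zero).hasGradientAt.hasFDerivAt
    have dv := ((hv.contDiffAt (hO.mem_nhds hy)).differentiableAt
      one_ne_zero).hasGradientAt.hasFDerivAt
    rw [hgu] at du
    rw [hgv] at dv
    have hgF : gradient F y = (m y ^ 2 * p) • (u y ^ p • a - v y ^ p • b)
        + ((u y ^ p - v y ^ p) * (2 * m y)) • (a - b) := by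
      have hd := ((du.rpow_const (p := p) (Or.inl hu0.ne')).sub
        (dv.rpow_const (p := p) (Or.inl hv0.ne'))).mul
        ((hasDerivAt_max_zero_sq _).comp_hasFDerivAt y
          (((du.log hu0.ne').sub (dv.log hv0.ne')).sub_const ε))
      refine HasGradientAt.gradient (hasGradientAt_iff_hasFDerivAt.2
        ((hd.congr_of_eventuallyEq (hFG y hy)).congr_fderiv ?_))
      have e1 : u y ^ (p - 1) * u y = u y ^ p := by
        rw [← Real.rpow_add_one hu0.ne', sub_add_cancel]
      have e2 : v y ^ (p - 1) * v y = v y ^ p := by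
        rw [← Real.rpow_add_one hv0.ne', sub_add_cancel]
      simp only [map_add, map_sub, map_smul, smul_smul, inv_mul_cancel₀ hu0.ne',
        inv_mul_cancel₀ hv0.ne', hm, Pi.sub_apply, Function.comp_apply]
      rw [← e1, ← e2]
      module
    have hFy : F y = (u y ^ p - v y ^ p) * m y ^ 2 := indicator_of_mem hy _
    simp only [Qu, Qv, ← ha, ← hb]
    simp only [hgF, hFy, normPowRemainder, inner_add_right, inner_sub_right,
      real_inner_smul_right, real_inner_comm a b]
    field_simp
    ring
  have hcoef : ∀ y ∈ O, 0 ≤ (u y ^ p - v y ^ p) * (2 * m y) / p := fun y hy => by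
    refine div_nonneg ?_ (by linarith)
    rcases le_or_gt (Real.log (u y) - Real.log (v y) - ε) 0 with h | h
    · simp [hm, max_eq_right h]
    · refine mul_nonneg (sub_nonneg.2 ?_) (by positivity)
      exact Real.rpow_le_rpow (hvpos' y hy).le
        ((Real.log_le_log_iff (hvpos' y hy) (hupos' y hy)).1 (by linarith)) (by linarith)
  have hnonneg : ∀ y ∈ O, 0 ≤ Qu y - Qv y := fun y hy => by
    have h1 := hcoef y hy
    have h2 := hupos' y hy
    have h3 := hvpos' y hy
    rw [hkey y hy]
    exact add_nonneg (mul_nonneg (by positivity) (normPowRemainder_nonneg hp _ _))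
      (mul_nonneg (by positivity) (normPowRemainder_nonneg hp _ _))
  have hae := (setIntegral_eq_zero_iff_of_nonneg_ae
    (ae_restrict_of_forall_mem hO.measurableSet hnonneg) (iu.sub iv)).1 hzero
  have hQ0 : Qu x - Qv x = 0 :=
    Measure.eqOn_open_of_ae_eq hae hO (cu.sub cv) continuousOn_const hx
  by_contra hne
  have hmx : 0 < m x := lt_max_of_lt_left (by linarith)
  have h1 := hcoef x hx
  have h2 := hupos' x hx
  have h3 := hvpos' x hx
  rw [hkey x hx] at hQ0
  have hpos : 0 < (m x ^ 2 * u x ^ p + (u x ^ p - v x ^ p) * (2 * m x) / p) *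
      normPowRemainder p ((u x)⁻¹ • gradient u x) ((v x)⁻¹ • gradient v x) :=
    mul_pos (by positivity) (normPowRemainder_pos hp hne)
  have hnn : 0 ≤ (m x ^ 2 * v x ^ p + (u x ^ p - v x ^ p) * (2 * m x) / p) *
      normPowRemainder p ((v x)⁻¹ • gradient v x) ((u x)⁻¹ • gradient u x) :=
    mul_nonneg (by positivity) (normPowRemainder_nonneg hp _ _)
  linarith

lemma not_isWeakSolution_fin_zero {p lam : ℝ} (hlam : 0 < lam)
    {O : Set (EuclideanSpace ℝ (Fin 0))} (hO : IsOpen O) {x : EuclideanSpace ℝ (Fin 0)}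
    (hx : x ∈ O) {u : EuclideanSpace ℝ (Fin 0) → ℝ} (hpos : ∀ x ∈ O, 0 < u x) :
    ¬ IsWeakSolution p O u fun x => lam * u x ^ (p - 1) := fun h => by
  have htest : IsTestFun O fun _ => 1 :=
    ⟨contDiff_const, HasCompactSupport.of_compactSpace _, fun y _ => Subsingleton.elim x y ▸ hx⟩
  have h0 := h _ htest
  have hgrad : ∀ y, gradient u y = 0 := fun y => Subsingleton.elim _ _
  simp only [hgrad, inner_zero_left, mul_zero, integral_zero, mul_one] at h0
  have hcont : Continuous fun y => lam * u y ^ (p - 1) := continuous_of_const fun y z => by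
    rw [Subsingleton.elim y z]
  have hae := (setIntegral_eq_zero_iff_of_nonneg_ae (ae_restrict_of_forall_mem hO.measurableSet
    fun y hy => mul_nonneg hlam.le (Real.rpow_nonneg (hpos y hy).le _))
    (hcont.integrable_of_hasCompactSupport (HasCompactSupport.of_compactSpace _)).integrableOn).1
    h0.symm
  have := Measure.eqOn_open_of_ae_eq hae hO hcont.continuousOn continuousOn_const hx
  exact (mul_pos hlam (Real.rpow_pos_of_pos (hpos x hx) _)).ne' this

lemma frontier_nonempty_of_isBounded {E : Type*} [NormedAddCommGroup E] [NormedSpace ℝ E]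
    [Nontrivial E] {s : Set E} (hs : s.Nonempty) (hb : Bornology.IsBounded s) :
    (frontier s).Nonempty := by
  refine nonempty_frontier_iff.2 ⟨hs, fun h => ?_⟩
  rw [h] at hb
  exact NormedSpace.unbounded_univ ℝ E hb

/-- Uniqueness part of Proposition 4.1 (Lindqvist-type uniqueness): two positive
solutions of `-Δ_p w = λ w^{p-1}` agreeing on the boundary coincide. -/
theorem uniqueness_positive_solutions
    (N : ℕ) (p : ℝ) (hp : 1 < p) (O : Set (EuclideanSpace ℝ (Fin N)))
    (hOo : IsOpen O) (hOconn : IsConnected O) (hObdd : Bornology.IsBounded O)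
    (lam : ℝ) (hlam : 0 < lam)
    (u v : EuclideanSpace ℝ (Fin N) → ℝ)
    (hu1 : C1OnClosure O u) (hv1 : C1OnClosure O v)
    (hupos : ∀ x ∈ closure O, 0 < u x) (hvpos : ∀ x ∈ closure O, 0 < v x)
    (husol : IsWeakSolution p O u (fun x => lam * u x ^ (p - 1)))
    (hvsol : IsWeakSolution p O v (fun x => lam * v x ^ (p - 1)))
    (hbdry : ∀ x ∈ frontier O, u x = v x) :
    ∀ x ∈ O, u x = v x := by
  have hNE : Nontrivial (EuclideanSpace ℝ (Fin N)) := by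
    rcases Nat.eq_zero_or_pos N with rfl | hN
    · obtain ⟨x, hx⟩ := hOconn.nonempty
      exact absurd husol
        (not_isWeakSolution_fin_zero hlam hOo hx fun y hy => hupos y (subset_closure hy))
    · have : Nonempty (Fin N) := ⟨⟨0, hN⟩⟩
      infer_instance
  obtain ⟨Wu, hWu, hOWu, hu⟩ := hu1
  obtain ⟨Wv, hWv, hOWv, hv⟩ := hv1
  have huO : ContDiffOn ℝ 1 u O := hu.mono (subset_closure.trans hOWu)
  have hvO : ContDiffOn ℝ 1 v O := hv.mono (subset_closure.trans hOWv)
  have huc : ContinuousOn u (closure O) := hu.continuousOn.mono hOWu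
  have hvc : ContinuousOn v (closure O) := hv.continuousOn.mono hOWv
  have hlog : ∀ x ∈ O, u x ≠ v x → (u x)⁻¹ • gradient u x = (v x)⁻¹ • gradient v x := by
    intro x hx hne
    rcases lt_or_gt_of_ne hne with h | h
    · exact (inv_smul_gradient_eq_of_lt hp hOo hObdd hvO huO hvc huc hvpos hupos hvsol husol
        (fun y hy => (hbdry y hy).symm) hx h).symm
    · exact inv_smul_gradient_eq_of_lt hp hOo hObdd huO hvO huc hvc hupos hvpos husol hvsol
        hbdry hx h
  set f : EuclideanSpace ℝ (Fin N) → ℝ := fun x => (Real.log (u x) - Real.log (v x)) ^ 2 with hf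
  have hder : ∀ x ∈ O, HasFDerivAt f (0 : EuclideanSpace ℝ (Fin N) →L[ℝ] ℝ) x := fun x hx => by
    have du := ((huO.contDiffAt (hOo.mem_nhds hx)).differentiableAt
      one_ne_zero).hasGradientAt.hasFDerivAt.log (hupos x (subset_closure hx)).ne'
    have dv := ((hvO.contDiffAt (hOo.mem_nhds hx)).differentiableAt
      one_ne_zero).hasGradientAt.hasFDerivAt.log (hvpos x (subset_closure hx)).ne'
    refine ((du.sub dv).pow 2).congr_fderiv ?_
    by_cases hne : u x = v x
    · simp [hne]
    · rw [← map_smul, ← map_smul, hlog x hx hne, sub_self, smul_zero]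
  obtain ⟨c, hc⟩ := hOo.exists_is_const_of_fderiv_eq_zero hOconn.isPreconnected
    (fun x hx => (hder x hx).differentiableAt.differentiableWithinAt)
    fun x hx => (hder x hx).fderiv
  have hfc : ContinuousOn f (closure O) := ((huc.log fun y hy => (hupos y hy).ne').sub
    (hvc.log fun y hy => (hvpos y hy).ne')).pow 2
  have hcl : EqOn f (fun _ => c) (closure O) :=
    EqOn.of_subset_closure hc hfc continuousOn_const subset_closure subset_rfl
  obtain ⟨z, hz⟩ := frontier_nonempty_of_isBounded hOconn.nonempty hObdd
  have hc0 : c = 0 := by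
    have hfz : f z = c := hcl (frontier_subset_closure hz)
    rw [← hfz]
    simp [hf, hbdry z hz]
  intro x hx
  have h0 : (Real.log (u x) - Real.log (v x)) ^ 2 = 0 := (hc x hx).trans hc0
  exact Real.log_injOn_pos (hupos x (subset_closure hx)) (hvpos x (subset_closure hx))
    (sub_eq_zero.1 (pow_eq_zero_iff two_ne_zero |>.1 h0))

end
end

section
/- (Barrier lemma.) Let 1 < p < ∞, N ≥ 1, z0 ∈ ℝ^N, R > 0, and for K > 0, α > 0 set b(x) = K (e^{−α|x−z0|²} − e^{−αR²}). If α ≥ 2(N+p−2)/((p−1)R²), then for every K > 0 and every x with R/2 ≤ |x − z0| ≤ R one has ∇b(x) ≠ 0 and the classical p-Laplacian satisfies −Δ_p b(x) ≤ 0, i.e. div(|∇b|^{p−2} ∇b)(x) ≥ 0. Moreover b > 0 on {R/2 ≤ |x−z0| < R}, b ≡ 0 on {|x−z0| = R}, and the radial derivative of b is strictly negative on {|x−z0| = R}. -/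
open MeasureTheory RealInnerProductSpace Metric Set

noncomputable section

theorem hasFDerivAt_comp_norm_sub_sq {N : ℕ} {f : ℝ → ℝ} {f' : ℝ}
    {z0 x : EuclideanSpace ℝ (Fin N)} (hf : HasDerivAt f f' (‖x - z0‖ ^ 2)) :
    HasFDerivAt (fun z => f (‖z - z0‖ ^ 2)) ((2 * f') • innerSL ℝ (x - z0)) x := by
  have h := hf.comp_hasFDerivAt x ((hasFDerivAt_id x).sub_const z0).norm_sq
  refine h.congr_fderiv ?_
  ext v
  simp
  ring

theorem hasGradientAt_comp_norm_sub_sq {N : ℕ} {f : ℝ → ℝ} {f' : ℝ}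
    {z0 x : EuclideanSpace ℝ (Fin N)} (hf : HasDerivAt f f' (‖x - z0‖ ^ 2)) :
    HasGradientAt (fun z => f (‖z - z0‖ ^ 2)) ((2 * f') • (x - z0)) x := by
  rw [hasGradientAt_iff_hasFDerivAt]
  refine (hasFDerivAt_comp_norm_sub_sq hf).congr_fderiv ?_
  ext v
  simp

theorem divergence_radial {N : ℕ} {g : ℝ → ℝ} {g' : ℝ}
    {z0 x : EuclideanSpace ℝ (Fin N)} (hg : HasDerivAt g g' (‖x - z0‖ ^ 2)) :
    divergence (fun z => g (‖z - z0‖ ^ 2) • (z - z0)) x =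
      N * g (‖x - z0‖ ^ 2) + 2 * g' * ‖x - z0‖ ^ 2 := by
  have h : HasFDerivAt (fun z => g (‖z - z0‖ ^ 2) • (z - z0)) _ x :=
    (hasFDerivAt_comp_norm_sub_sq hg).fun_smul ((hasFDerivAt_id x).sub_const z0)
  have htrace : LinearMap.trace ℝ (EuclideanSpace ℝ (Fin N))
      (((2 * g') • (innerSL ℝ (x - z0)).toLinearMap).smulRight (x - z0)) =
      2 * g' * ‖x - z0‖ ^ 2 := by
    rw [LinearMap.trace_smulRight, ← real_inner_self_eq_norm_sq]
    rfl
  have hid : LinearMap.trace ℝ (EuclideanSpace ℝ (Fin N))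
      (ContinuousLinearMap.id ℝ (EuclideanSpace ℝ (Fin N))).toLinearMap = N := by
    simp
  unfold divergence
  rw [h.fderiv, ← htrace, ← hid, mul_comm _ (g _), ← smul_eq_mul (g _),
    ← map_smul (LinearMap.trace ℝ (EuclideanSpace ℝ (Fin N))), ← map_add]
  rfl

theorem gradient_gaussian_barrier {N : ℕ} (z0 x : EuclideanSpace ℝ (Fin N)) (α K c : ℝ) :
    gradient (fun z => K * (Real.exp (-α * ‖z - z0‖ ^ 2) - c)) x =
      (-(2 * K * α * Real.exp (-α * ‖x - z0‖ ^ 2))) • (x - z0) := by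
  have h : HasDerivAt (fun s : ℝ => K * (Real.exp (-α * s) - c))
      (K * (Real.exp (-α * ‖x - z0‖ ^ 2) * (-α * 1))) (‖x - z0‖ ^ 2) :=
    ((((hasDerivAt_id _).const_mul (-α)).exp).sub_const c).const_mul K
  rw [(hasGradientAt_comp_norm_sub_sq h).gradient]
  congr 1
  ring

theorem pLapAt_gaussian_barrier {N : ℕ} {z0 x : EuclideanSpace ℝ (Fin N)} {p α K c : ℝ}
    (hα : 0 < α) (hK : 0 < K) (hx : x ≠ z0) :
    pLapAt p (fun z => K * (Real.exp (-α * ‖z - z0‖ ^ 2) - c)) x =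
      (2 * K * α) ^ (p - 1) * Real.exp (-(α * (p - 1)) * ‖x - z0‖ ^ 2) *
        (‖x - z0‖ ^ 2) ^ ((p - 2) / 2) * (2 * α * (p - 1) * ‖x - z0‖ ^ 2 - (N + p - 2)) := by
  have hs : 0 < ‖x - z0‖ ^ 2 := by
    have := norm_pos_iff.mpr (sub_ne_zero.mpr hx)
    positivity
  have hfield : (fun z => ‖gradient (fun z => K * (Real.exp (-α * ‖z - z0‖ ^ 2) - c)) z‖ ^ (p - 2) •
        gradient (fun z => K * (Real.exp (-α * ‖z - z0‖ ^ 2) - c)) z) =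
      fun z => (fun s : ℝ => -(2 * K * α) ^ (p - 1) *
        (Real.exp (-(α * (p - 1)) * s) * s ^ ((p - 2) / 2))) (‖z - z0‖ ^ 2) • (z - z0) := by
    funext z
    have hc : 0 < 2 * K * α := by positivity
    rw [gradient_gaussian_barrier, smul_smul, norm_smul, norm_neg, Real.norm_of_nonneg
      (by positivity), Real.mul_rpow (by positivity) (norm_nonneg _),
      Real.mul_rpow hc.le (Real.exp_pos _).le]
    congr 1
    have h1 : (2 * K * α) ^ (p - 1) = (2 * K * α) ^ (p - 2) * (2 * K * α) := by
      rw [← Real.rpow_add_one hc.ne']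
      ring_nf
    have h2 : (‖z - z0‖ ^ 2) ^ ((p - 2) / 2) = ‖z - z0‖ ^ (p - 2) := by
      rw [← Real.rpow_natCast_mul (norm_nonneg _)]
      congr 1
      push_cast
      ring
    have h3 : Real.exp (-(α * (p - 1)) * ‖z - z0‖ ^ 2) =
        Real.exp (-α * ‖z - z0‖ ^ 2) ^ (p - 2) * Real.exp (-α * ‖z - z0‖ ^ 2) := by
      rw [← Real.exp_mul, ← Real.exp_add]
      ring_nf
    simp only [h1, h2, h3]
    ring
  have hg : HasDerivAt (fun s : ℝ => -(2 * K * α) ^ (p - 1) *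
      (Real.exp (-(α * (p - 1)) * s) * s ^ ((p - 2) / 2))) _ (‖x - z0‖ ^ 2) := ((((hasDerivAt_id (‖x - z0‖ ^ 2)).const_mul (-(α * (p - 1)))).exp).fun_mul
    (Real.hasDerivAt_rpow_const (p := (p - 2) / 2) (Or.inl hs.ne'))).const_mul
      (-(2 * K * α) ^ (p - 1))
  have hpow : (‖x - z0‖ ^ 2) ^ ((p - 2) / 2 - 1) * ‖x - z0‖ ^ 2 =
      (‖x - z0‖ ^ 2) ^ ((p - 2) / 2) := by
    rw [← Real.rpow_add_one hs.ne', sub_add_cancel]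
  unfold pLapAt
  rw [hfield, divergence_radial hg]
  simp only [id]
  linear_combination (-(2 * K * α) ^ (p - 1)) * (p - 2) *
    Real.exp (-(α * (p - 1)) * ‖x - z0‖ ^ 2) * hpow

/-- Barrier lemma: for `b(x) = K(e^{-α|x-z0|²} - e^{-αR²})` with
`α ≥ 2(N+p-2)/((p-1)R²)`, on the annulus `R/2 ≤ |x-z0| ≤ R` one has `∇b ≠ 0` and
`-Δ_p b ≤ 0`; moreover `b > 0` on `{R/2 ≤ |x-z0| < R}`, `b ≡ 0` on `{|x-z0| = R}`, and
the radial derivative of `b` is strictly negative on `{|x-z0| = R}`. -/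
theorem barrier_lemma
    (N : ℕ) (hN : 1 ≤ N) (p : ℝ) (hp : 1 < p)
    (z0 : EuclideanSpace ℝ (Fin N)) (R α K : ℝ)
    (hR : 0 < R) (hα0 : 0 < α) (hK : 0 < K)
    (hα : 2 * ((N : ℝ) + p - 2) / ((p - 1) * R ^ 2) ≤ α)
    (b : EuclideanSpace ℝ (Fin N) → ℝ)
    (hb : b = fun x => K * (Real.exp (-α * ‖x - z0‖ ^ 2) - Real.exp (-α * R ^ 2))) :
    (∀ x : EuclideanSpace ℝ (Fin N), R / 2 ≤ ‖x - z0‖ → ‖x - z0‖ ≤ R →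
      gradient b x ≠ 0 ∧ 0 ≤ pLapAt p b x) ∧
    (∀ x : EuclideanSpace ℝ (Fin N), R / 2 ≤ ‖x - z0‖ → ‖x - z0‖ < R → 0 < b x) ∧
    (∀ x : EuclideanSpace ℝ (Fin N), ‖x - z0‖ = R → b x = 0) ∧
    (∀ x : EuclideanSpace ℝ (Fin N), ‖x - z0‖ = R →
      ⟪gradient b x, ‖x - z0‖⁻¹ • (x - z0)⟫ < 0) := by
  subst hb
  refine ⟨fun x hx1 hx2 => ?_, fun x _ hx2 => ?_, fun x hx => ?_, fun x hx => ?_⟩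
  · have hpos : 0 < ‖x - z0‖ := by linarith
    have hne : x - z0 ≠ 0 := norm_pos_iff.mp hpos
    refine ⟨?_, ?_⟩
    · rw [gradient_gaussian_barrier]
      refine smul_ne_zero (neg_ne_zero.mpr ?_) hne
      positivity
    · rw [pLapAt_gaussian_barrier hα0 hK (sub_ne_zero.mp hne)]
      refine mul_nonneg (by positivity) ?_
      have hp1 : 0 < p - 1 := by linarith
      rw [div_le_iff₀ (by positivity)] at hα
      have hsq : R ^ 2 ≤ 4 * ‖x - z0‖ ^ 2 := by nlinarith
      have := mul_le_mul_of_nonneg_left hsq (mul_pos hα0 hp1).le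
      linarith
  · have hlt : ‖x - z0‖ ^ 2 < R ^ 2 := pow_lt_pow_left₀ hx2 (norm_nonneg _) two_ne_zero
    refine mul_pos hK (sub_pos.mpr (Real.exp_lt_exp.mpr ?_))
    nlinarith
  · simp [hx]
  · rw [gradient_gaussian_barrier, inner_smul_left, inner_smul_right,
      real_inner_self_eq_norm_sq, hx]
    simp only [conj_trivial, neg_mul, neg_lt_zero]
    positivity

end
end
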